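/- Let S be an arbitrary set of positive integers, h ≥ 1, and let S' = ℕ₊ \ { m·h : m ∈ ℕ₊ \ S }. Then for all n, G_{S'}(n) = G_S(⌊n/h⌋)·h + (n mod h); that is, the Grundy sequence of Subtraction(S') is the h-stair of the Grundy sequence of Subtraction(S). -/

import Mathlib

open Finset

/-- mex of a set of naturals. -/
noncomputable def mex (T : Set ℕ) : ℕ := sInf Tᶜ

/-- Grundy value of the subtraction game Subtraction(S) on a heap of size x. -/
noncomputable def subG (S : Set ℕ) (x : ℕ) : ℕ :=
  mex {g | ∃ s, ∃ _ : s ∈ S ∧ 0 < s ∧ s ≤ x, g = subG S (x - s)}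
termination_by x
decreasing_by rename_i hs; obtain ⟨_, h1, h2⟩ := hs; omega

/-- Moves of the generalized cyclic Nimhoff GCN(h; S_1, ..., S_n). -/
def gcnMove {n : ℕ} (h : ℕ) (S : Fin n → Set ℕ) (x y : Fin n → ℕ) : Prop :=
  (∃ i, ∃ s, s ∈ S i ∧ 0 < s ∧ s ≤ x i ∧ y = Function.update x i (x i - s)) ∨
  (∃ s : Fin n → ℕ, (∀ i, s i ≤ x i) ∧ 0 < ∑ i, s i ∧ ∑ i, s i < h ∧
    y = fun i => x i - s i)

theorem gcnMove_sum_lt {n h : ℕ} {S : Fin n → Set ℕ} {x y : Fin n → ℕ}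
    (m : gcnMove h S x y) : ∑ i, y i < ∑ i, x i := by
  rcases m with ⟨i, s, _, hs0, hsx, rfl⟩ | ⟨s, hle, hpos, _, rfl⟩
  · refine Finset.sum_lt_sum (fun j _ => ?_) ⟨i, Finset.mem_univ i, ?_⟩
    · by_cases hj : j = i
      · subst hj; simp [Function.update]
      · simp [Function.update, hj]
    · simp [Function.update]; omega
  · obtain ⟨i, _, hi⟩ := Finset.exists_ne_zero_of_sum_ne_zero (by omega :
      ∑ i, s i ≠ 0)
    refine Finset.sum_lt_sum (fun j _ => by omega) ⟨i, Finset.mem_univ i, ?_⟩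
    have := hle i; omega

/-- Grundy value of a position of the generalized cyclic Nimhoff. -/
noncomputable def gcnGrundy (n h : ℕ) (S : Fin n → Set ℕ) (x : Fin n → ℕ) : ℕ :=
  mex {g | ∃ y, ∃ _ : gcnMove h S x y, g = gcnGrundy n h S y}
termination_by ∑ i, x i
decreasing_by exact gcnMove_sum_lt ‹_›

theorem subG_ne_of_move (S : Set ℕ) (x s : ℕ) (hs : s ∈ S) (h0 : 0 < s) (hx : s ≤ x) :
    subG S (x - s) ≠ subG S x := by
  intro heq
  have hfin : {g | ∃ s, ∃ _ : s ∈ S ∧ 0 < s ∧ s ≤ x, g = subG S (x - s)}.Finite := by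
    refine ((Set.finite_Iic x).image (fun s => subG S (x - s))).subset ?_
    rintro g ⟨t, ⟨_, _, ht⟩, rfl⟩
    exact ⟨t, ht, rfl⟩
  have hmem := Nat.sInf_mem hfin.infinite_compl.nonempty
  apply hmem
  refine ⟨s, ⟨hs, h0, hx⟩, ?_⟩
  rw [heq, subG]
  rfl

theorem exists_move_of_lt_subG (S : Set ℕ) (x a : ℕ) (ha : a < subG S x) :
    ∃ s, s ∈ S ∧ 0 < s ∧ s ≤ x ∧ a = subG S (x - s) := by
  rw [subG] at ha
  have := Nat.notMem_of_lt_sInf ha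
  rw [Set.notMem_compl_iff] at this
  obtain ⟨s, ⟨h1, h2, h3⟩, h4⟩ := this
  exact ⟨s, h1, h2, h3, h4⟩

theorem subG_eq_of (S : Set ℕ) (x v : ℕ)
    (h1 : ∀ s ∈ S, 0 < s → s ≤ x → subG S (x - s) ≠ v)
    (h2 : ∀ w < v, ∃ s, s ∈ S ∧ 0 < s ∧ s ≤ x ∧ subG S (x - s) = w) :
    subG S x = v := by
  rcases lt_trichotomy (subG S x) v with h | h | h
  · obtain ⟨s, a, b, c, d⟩ := h2 _ h
    exact absurd d (subG_ne_of_move S x s a b c)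
  · exact h
  · obtain ⟨s, a, b, c, d⟩ := exists_move_of_lt_subG S x v h
    exact absurd d.symm (h1 s a b c)

/-- `S' = ℕ₊ \ {m·h : m ∈ ℕ₊ \ S}` has the `h`-stair of the Grundy
sequence of `Subtraction(S)` as its Grundy sequence. -/
theorem subG_stair_of_complement (h : ℕ) (hh : 0 < h) (S : Set ℕ)
    (hS : ∀ s ∈ S, 0 < s) (n : ℕ) :
    subG {m : ℕ | 0 < m ∧ ¬∃ k, 0 < k ∧ k ∉ S ∧ m = k * h} n =
      subG S (n / h) * h + n % h := by
  have stair : ∀ a b c d : ℕ, b < h → d < h → a * h + b = c * h + d → a = c ∧ b = d := by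
    intro a b c d hb hd e
    have e1 : (a * h + b) / h = a := by
      rw [add_comm, Nat.add_mul_div_right _ _ hh, Nat.div_eq_of_lt hb, zero_add]
    have e2 : (c * h + d) / h = c := by
      rw [add_comm, Nat.add_mul_div_right _ _ hh, Nat.div_eq_of_lt hd, zero_add]
    have hac : a = c := by rw [← e1, e, e2]
    subst hac
    exact ⟨rfl, by omega⟩
  have dm : ∀ a b : ℕ, b < h → (a * h + b) / h = a ∧ (a * h + b) % h = b := by
    intro a b hb
    refine stair _ _ _ _ (Nat.mod_lt _ hh) hb ?_
    rw [mul_comm]; exact Nat.div_add_mod _ _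
  induction n using Nat.strong_induction_on with
  | _ n ih =>
  obtain ⟨q, r, hr, rfl⟩ : ∃ q r, r < h ∧ n = q * h + r :=
    ⟨n / h, n % h, Nat.mod_lt _ hh, by rw [mul_comm]; exact (Nat.div_add_mod _ _).symm⟩
  rw [(dm q r hr).1, (dm q r hr).2]
  apply subG_eq_of
  · rintro s ⟨hs0, hs⟩ _ hsx heq
    rw [ih _ (by omega)] at heq
    obtain ⟨p, t, ht, hpt⟩ : ∃ p t, t < h ∧ q * h + r - s = p * h + t :=
      ⟨_, _, Nat.mod_lt _ hh, (Nat.div_add_mod' _ _).symm⟩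
    rw [hpt, (dm p t ht).1, (dm p t ht).2] at heq
    obtain ⟨hG, rfl⟩ := stair _ _ _ _ ht hr heq
    have hpq : p < q := by
      by_contra hc
      have := Nat.mul_le_mul_right h (not_lt.mp hc)
      omega
    obtain ⟨k, rfl⟩ := Nat.exists_eq_add_of_lt hpq
    apply hs
    refine ⟨k + 1, by omega, ?_, ?_⟩
    · intro hk
      apply subG_ne_of_move S (p + k + 1) (k + 1) hk (by omega) (by omega)
      rw [← hG]; congr 1; omega
    · have : (p + k + 1) * h = p * h + (k + 1) * h := by ring
      omega
  · intro w hw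
    obtain ⟨a, b, hb, rfl⟩ : ∃ a b, b < h ∧ w = a * h + b :=
      ⟨w / h, w % h, Nat.mod_lt _ hh, by rw [mul_comm]; exact (Nat.div_add_mod _ _).symm⟩
    rcases lt_trichotomy a (subG S q) with hlt | heq | hgt
    · obtain ⟨s, hsS, hs0, hsq, hsa⟩ := exists_move_of_lt_subG S q a hlt
      obtain ⟨p, rfl⟩ := Nat.exists_eq_add_of_le hsq
      rw [Nat.add_sub_cancel_left] at hsa
      have e : (s + p) * h = s * h + p * h := by ring
      have hle : h ≤ s * h := Nat.le_mul_of_pos_left h hs0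
      have e2 : (s + p) * h + r - (s * h + r - b) = p * h + b := by omega
      refine ⟨s * h + r - b, ⟨by omega, ?_⟩, by omega, by omega, ?_⟩
      · rintro ⟨k, hk0, hkS, hk⟩
        have := stair s r k b hr hb (by omega)
        exact hkS (this.1 ▸ hsS)
      · rw [ih _ (by omega), e2, (dm p b hb).1, (dm p b hb).2, hsa]
    · subst heq
      have e2 : q * h + r - (r - b) = q * h + b := by omega
      refine ⟨r - b, ⟨by omega, ?_⟩, by omega, by omega, ?_⟩
      · rintro ⟨k, hk0, hkS, hk⟩
        have : h ≤ k * h := Nat.le_mul_of_pos_left h hk0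
        omega
      · rw [ih _ (by omega), e2, (dm q b hb).1, (dm q b hb).2]
    · have := Nat.mul_le_mul_right h (Nat.succ_le_of_lt hgt)
      have e : (subG S q).succ * h = subG S q * h + h := Nat.succ_mul _ _
      omega
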